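/- Let m, k ≥ 1 be integers with m ≥ k, and let g : ℝ → ℝ be an even 2π-periodic function of class C^k with ‖g^{(k)}‖_∞ ≤ 1, with Fourier cosine expansion g(x) = Σ_{i=0}^∞ c_i·cos(ix). Then there exists a trigonometric polynomial g̃_m(x) = Σ_{i=0}^m c̃_i·cos(ix) of degree at most m such that ‖g − g̃_m‖_∞ ≤ C₁^k/m^k for an absolute constant C₁, and |c̃_i| ≤ |c_i| for all 0 ≤ i ≤ m. -/

import Mathlib

open scoped ENNReal
open MeasureTheory

noncomputable section

/-- The cube `[-1,1]^d`. -/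
def cube (d : ℕ) : Set (Fin d → ℝ) := Set.univ.pi fun _ => Set.Icc (-1 : ℝ) 1

/-- Two datasets differ in at most one entry. -/
def Adjacent {n : ℕ} {Ω : Type*} (X X' : Fin n → Ω) : Prop :=
  ∃ i₀ : Fin n, ∀ i, i ≠ i₀ → X i = X' i

/-- Partial derivative in the `i`-th coordinate direction. -/
def pderiv' {d : ℕ} (i : Fin d) (f : (Fin d → ℝ) → ℝ) : (Fin d → ℝ) → ℝ :=
  fun x => fderiv ℝ f x (Pi.single i 1)

/-- Multi-index partial derivative `∂^α`. -/
def mderiv {d : ℕ} (α : Fin d → ℕ) (f : (Fin d → ℝ) → ℝ) : (Fin d → ℝ) → ℝ :=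
  (List.finRange d).foldr (fun i g => (pderiv' i)^[α i] g) f

/-- Order `|α| = Σ αᵢ` of a multi-index. -/
def mdeg {d : ℕ} (α : Fin d → ℕ) : ℕ := ∑ i, α i

/-- The `k`-smooth class `F_k` on `[-1,1]^d`: `C^k` functions all of whose partial
derivatives of order between `1` and `k` are bounded by `1` on the cube. -/
def memFk (d k : ℕ) (f : (Fin d → ℝ) → ℝ) : Prop :=
  ContDiff ℝ k f ∧
  ∀ α : Fin d → ℕ, 1 ≤ mdeg α → mdeg α ≤ k → ∀ x ∈ cube d, |mderiv α f x| ≤ 1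

/-- The integral probability metric `d_k` associated with `F_k`. -/
def dIPM (d k : ℕ) (p q : Measure (Fin d → ℝ)) : ℝ :=
  ⨆ f : {f : (Fin d → ℝ) → ℝ // memFk d k f}, |(∫ x, f.1 x ∂p) - ∫ x, f.1 x ∂q|

/-- Empirical measure of a dataset. -/
def empMeasure {d n : ℕ} (X : Fin n → (Fin d → ℝ)) : Measure (Fin d → ℝ) :=
  (n : ℝ≥0∞)⁻¹ • ∑ i, Measure.dirac (X i)

/-- Empirical measure of a finite tuple encoded as (length, sequence). -/
def empOut {d : ℕ} (y : ℕ × (ℕ → Fin d → ℝ)) : Measure (Fin d → ℝ) :=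
  (y.1 : ℝ≥0∞)⁻¹ • ∑ i ∈ Finset.range y.1, Measure.dirac (y.2 i)

/-- Total variation distance between two measures. -/
def tvDist {α : Type*} [MeasurableSpace α] (P Q : Measure α) : ℝ :=
  ⨆ S : {S : Set α // MeasurableSet S}, |(P S.1).toReal - (Q S.1).toReal|

/-- Normalized one-dimensional Chebyshev polynomial. -/
def TbarN (n : ℕ) (x : ℝ) : ℝ :=
  if n = 0 then 1 else Real.sqrt 2 * Real.cos (n * Real.arccos x)

/-- Normalized multivariate Chebyshev polynomial `T̄_K`. -/
def TbarK {d : ℕ} (K : Fin d → ℕ) (x : Fin d → ℝ) : ℝ := ∏ i, TbarN (K i) (x i)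

/-- Normalized cosine functions `ψ_n`. -/
def psiN (n : ℕ) (t : ℝ) : ℝ := if n = 0 then 1 else Real.sqrt 2 * Real.cos (n * t)

/-- Multivariate cosine basis `ψ_K`. -/
def psiK {d : ℕ} (K : Fin d → ℕ) (θ : Fin d → ℝ) : ℝ := ∏ i, psiN (K i) (θ i)

/-- Chebyshev weight probability measure `dμ(x) = dx/(π√(1-x²))` on `[-1,1]`. -/
def chebMeasure : Measure ℝ :=
  (volume.restrict (Set.Icc (-1 : ℝ) 1)).withDensity
    fun x => ENNReal.ofReal (1 / (Real.pi * Real.sqrt (1 - x ^ 2)))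

/-- Product Chebyshev measure `μ_d` on `[-1,1]^d`. -/
def chebMeasureD (d : ℕ) : Measure (Fin d → ℝ) := Measure.pi fun _ => chebMeasure

/-- Normalized Lebesgue measure `π⁻¹ dθ` on `[0,π]`. -/
def thetaMeasure : Measure ℝ :=
  ENNReal.ofReal (1 / Real.pi) • volume.restrict (Set.Icc (0 : ℝ) Real.pi)

/-- Product measure `π^{-d} dθ` on `[0,π]^d`. -/
def thetaMeasureD (d : ℕ) : Measure (Fin d → ℝ) := Measure.pi fun _ => thetaMeasure

/-- `‖K‖₂` for a multi-index `K`. -/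
def normK {d : ℕ} (K : Fin d → ℕ) : ℝ := Real.sqrt (∑ i, ((K i : ℝ)) ^ 2)

/-- `P` is a trigonometric polynomial of degree at most `D` in each of the `d` variables. -/
def IsTrigPoly (d D : ℕ) (P : (Fin d → ℝ) → ℝ) : Prop :=
  ∃ a : ((Fin d → ℕ) × (Fin d → Bool)) → ℝ,
    ∀ θ, P θ =
      ∑ p ∈ (Fintype.piFinset fun _ : Fin d => Finset.range (D + 1)) ×ˢ
          (Finset.univ : Finset (Fin d → Bool)),
        a p * ∏ i, (if p.2 i then Real.sin ((p.1 i : ℝ) * θ i) else Real.cos ((p.1 i : ℝ) * θ i))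

/-- Convolution-type operator. -/
def jkT (J f : ℝ → ℝ) : ℝ → ℝ := fun x => ∫ t in (-Real.pi)..Real.pi, f (x + t) * J t

/-- The operator `I - T`. -/
def jkS (J f : ℝ → ℝ) : ℝ → ℝ := fun x => f x - jkT J f x

lemma jkT_continuous {J f : ℝ → ℝ} (hJ : Continuous J) (hf : Continuous f) :
    Continuous (jkT J f) := by
  unfold jkT
  apply intervalIntegral.continuous_parametric_intervalIntegral_of_continuous'
  simp only [Function.uncurry_def]
  fun_prop

lemma jkT_hasDerivAt {J f : ℝ → ℝ} (hJ : Continuous J) (hf : ContDiff ℝ 1 f) (x : ℝ) :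
    HasDerivAt (jkT J f) (jkT J (deriv f) x) x := by
  have hfc : Continuous f := hf.continuous
  have hd : Continuous (deriv f) := hf.continuous_deriv (le_refl _)
  have hpi := Real.pi_pos
  obtain ⟨M, hM⟩ := (isCompact_Icc (a := x - 1 - Real.pi) (b := x + 1 + Real.pi)).exists_bound_of_continuousOn
    hd.continuousOn
  unfold jkT
  refine (intervalIntegral.hasDerivAt_integral_of_dominated_loc_of_deriv_le
    (F := fun x t => f (x + t) * J t) (F' := fun x t => deriv f (x + t) * J t)
    (s := Metric.ball x 1) (bound := fun t => M * |J t|)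
    (Metric.ball_mem_nhds x one_pos) ?_ ?_ ?_ ?_ ?_ ?_).2
  · refine Filter.Eventually.of_forall fun y => ?_
    exact Continuous.aestronglyMeasurable (by fun_prop)
  · exact Continuous.intervalIntegrable (by fun_prop) _ _
  · exact Continuous.aestronglyMeasurable (by fun_prop)
  · refine Filter.Eventually.of_forall fun t ht y hy => ?_
    rw [Set.uIoc_of_le (by linarith)] at ht
    rw [Metric.mem_ball, Real.dist_eq, abs_lt] at hy
    rw [norm_mul]
    exact mul_le_mul_of_nonneg_right
      (hM _ ⟨by linarith [ht.1, hy.1], by linarith [ht.2, hy.2]⟩) (norm_nonneg _)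
  · exact Continuous.intervalIntegrable (by fun_prop) _ _
  · refine Filter.Eventually.of_forall fun t ht y hy => ?_
    have h1 : HasDerivAt f (deriv f (y + t)) (y + t) :=
      (hf.differentiable (by norm_num) _).hasDerivAt
    exact (h1.comp_add_const y t).mul_const _

lemma jkS_deriv {J f : ℝ → ℝ} (hJ : Continuous J) (hf : ContDiff ℝ 1 f) :
    Differentiable ℝ (jkS J f) ∧ deriv (jkS J f) = jkS J (deriv f) := by
  have h : ∀ x, HasDerivAt (jkS J f) (jkS J (deriv f) x) x := fun x =>
    ((hf.differentiable (by norm_num) x).hasDerivAt).sub (jkT_hasDerivAt hJ hf x)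
  exact ⟨fun x => (h x).differentiableAt, funext fun x => (h x).deriv⟩

lemma jkS_iter {J : ℝ → ℝ} (hJ : Continuous J) (k : ℕ) : ∀ f : ℝ → ℝ, ContDiff ℝ k f →
    ContDiff ℝ k (jkS J f) ∧ iteratedDeriv k (jkS J f) = jkS J (iteratedDeriv k f) := by
  induction k with
  | zero =>
    intro f hf
    have hc : Continuous f := hf.continuous
    refine ⟨?_, by simp⟩
    exact contDiff_zero.2 (hc.sub (jkT_continuous hJ hc))
  | succ k ih =>
    intro f hf
    have h1 : ContDiff ℝ 1 f := hf.of_le (by exact_mod_cast Nat.succ_le_succ (Nat.zero_le k))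
    obtain ⟨hd, he⟩ := jkS_deriv hJ h1
    have hf' : ContDiff ℝ k (deriv f) := by
      have := hf
      push_cast at this
      exact (contDiff_succ_iff_deriv.1 this).2.2
    obtain ⟨i1, i2⟩ := ih _ hf'
    constructor
    · push_cast
      refine contDiff_succ_iff_deriv.2 ⟨hd, by simp, ?_⟩
      rw [he]; exact i1
    · rw [iteratedDeriv_succ', he, i2, iteratedDeriv_succ']

lemma jkS_bound_one {J : ℝ → ℝ} (hJ : Continuous J) (hJ0 : ∀ t, 0 ≤ J t)
    (hJ1 : ∫ t in (-Real.pi)..Real.pi, J t = 1) {δ : ℝ}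
    (hδ : ∫ t in (-Real.pi)..Real.pi, |t| * J t ≤ δ) {B : ℝ} {f : ℝ → ℝ}
    (hf : ContDiff ℝ 1 f) (hB : ∀ x, |deriv f x| ≤ B) (x : ℝ) : |jkS J f x| ≤ B * δ := by
  have hfc := hf.continuous
  have hpi := Real.pi_pos
  have hB0 : 0 ≤ B := (abs_nonneg _).trans (hB 0)
  have e : jkS J f x = ∫ t in (-Real.pi)..Real.pi, (f x - f (x + t)) * J t := by
    simp only [sub_mul]
    rw [intervalIntegral.integral_sub, intervalIntegral.integral_const_mul, hJ1, mul_one]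
    · rfl
    · exact Continuous.intervalIntegrable (by fun_prop) _ _
    · exact Continuous.intervalIntegrable (by fun_prop) _ _
  rw [e]
  calc |∫ t in (-Real.pi)..Real.pi, (f x - f (x + t)) * J t|
      ≤ ∫ t in (-Real.pi)..Real.pi, |(f x - f (x + t)) * J t| :=
        intervalIntegral.abs_integral_le_integral_abs (by linarith)
    _ ≤ ∫ t in (-Real.pi)..Real.pi, B * (|t| * J t) := by
        apply intervalIntegral.integral_mono_on (by linarith)
        · exact Continuous.intervalIntegrable (by fun_prop) _ _
        · exact Continuous.intervalIntegrable (by fun_prop) _ _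
        · intro t _
          rw [abs_mul, abs_of_nonneg (hJ0 t), ← mul_assoc]
          refine mul_le_mul_of_nonneg_right ?_ (hJ0 t)
          have := Convex.norm_image_sub_le_of_norm_deriv_le (f := f) (s := Set.univ) (C := B)
            (x := x + t) (y := x) (fun y _ => hf.differentiable (by norm_num) y)
            (fun y _ => hB y) convex_univ trivial trivial
          simpa [Real.norm_eq_abs] using this
    _ = B * ∫ t in (-Real.pi)..Real.pi, |t| * J t := intervalIntegral.integral_const_mul _ _
    _ ≤ B * δ := mul_le_mul_of_nonneg_left hδ hB0

lemma jkS_bound {J : ℝ → ℝ} (hJ : Continuous J) (hJ0 : ∀ t, 0 ≤ J t)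
    (hJ1 : ∫ t in (-Real.pi)..Real.pi, J t = 1) {δ : ℝ}
    (hδ : ∫ t in (-Real.pi)..Real.pi, |t| * J t ≤ δ) (k : ℕ) : ∀ (B : ℝ) (f : ℝ → ℝ),
    ContDiff ℝ k f → (∀ x, |iteratedDeriv k f x| ≤ B) → ∀ x, |(jkS J)^[k] f x| ≤ B * δ ^ k := by
  induction k with
  | zero => intro B f _ hB x; simpa using hB x
  | succ k ih =>
    intro B f hf hB x
    have hfk : ContDiff ℝ k f := hf.of_le (by exact_mod_cast Nat.le_succ k)
    obtain ⟨h1, h2⟩ := jkS_iter hJ k f hfk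
    rw [Function.iterate_succ_apply]
    have h3 : ContDiff ℝ 1 (iteratedDeriv k f) := by
      rw [iteratedDeriv_eq_iterate]
      apply ContDiff.iterate_deriv'
      rw [add_comm]; exact_mod_cast hf
    have := ih (B * δ) (jkS J f) h1 (fun y => by
      rw [h2]
      refine jkS_bound_one hJ hJ0 hJ1 hδ h3 (fun z => ?_) y
      rw [← iteratedDeriv_succ]; exact hB z) x
    rw [pow_succ']; rw [← mul_assoc]; exact this

lemma jkS_hasSum {J f : ℝ → ℝ} (hJ : Continuous J) (hJe : ∀ t, J (-t) = J t) {c : ℕ → ℝ}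
    (hc : Summable fun i => |c i|)
    (hf : ∀ x, HasSum (fun i : ℕ => c i * Real.cos (i * x)) (f x)) (x : ℝ) :
    HasSum (fun i : ℕ => ((1 - ∫ t in (-Real.pi)..Real.pi, Real.cos (i * t) * J t) * c i)
      * Real.cos (i * x)) (jkS J f x) := by
  have hpi := Real.pi_pos
  have key : HasSum (fun i : ℕ => ∫ t in (-Real.pi)..Real.pi, c i * Real.cos (i * (x + t)) * J t)
      (jkT J f x) := by
    unfold jkT
    apply intervalIntegral.hasSum_integral_of_dominated_convergence
      (fun i t => |c i| * |J t|)
    · intro i; exact Continuous.aestronglyMeasurable (by fun_prop)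
    · intro i
      refine Filter.Eventually.of_forall fun t _ => ?_
      rw [norm_mul, norm_mul]
      refine mul_le_mul_of_nonneg_right ?_ (norm_nonneg _)
      exact mul_le_of_le_one_right (norm_nonneg _) (Real.abs_cos_le_one _)
    · exact Filter.Eventually.of_forall fun t _ => hc.mul_right _
    · simp only [tsum_mul_right]
      exact Continuous.intervalIntegrable (by fun_prop) _ _
    · exact Filter.Eventually.of_forall fun t _ => (hf (x + t)).mul_right _
  have hs : ∀ i : ℕ, ∫ t in (-Real.pi)..Real.pi, Real.sin (i * t) * J t = 0 := by
    intro i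
    have h := intervalIntegral.integral_comp_neg (a := -Real.pi) (b := Real.pi)
      (fun t => Real.sin (i * t) * J t)
    simp only [hJe, mul_neg, Real.sin_neg, neg_mul, neg_neg, intervalIntegral.integral_neg] at h
    linarith
  have e : ∀ i : ℕ, ∫ t in (-Real.pi)..Real.pi, c i * Real.cos (i * (x + t)) * J t
      = (∫ t in (-Real.pi)..Real.pi, Real.cos (i * t) * J t) * c i * Real.cos (i * x) := by
    intro i
    have : ∀ t, c i * Real.cos (i * (x + t)) * J t
        = (c i * Real.cos (i * x)) * (Real.cos (i * t) * J t)
          - (c i * Real.sin (i * x)) * (Real.sin (i * t) * J t) := by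
      intro t; rw [mul_add, Real.cos_add]; ring
    simp only [this]
    rw [intervalIntegral.integral_sub, intervalIntegral.integral_const_mul,
      intervalIntegral.integral_const_mul, hs]
    · ring
    · exact Continuous.intervalIntegrable (by fun_prop) _ _
    · exact Continuous.intervalIntegrable (by fun_prop) _ _
  simp only [e] at key
  have := (hf x).sub key
  have e2 : (fun i : ℕ => ((1 - ∫ t in (-Real.pi)..Real.pi, Real.cos (i * t) * J t) * c i)
      * Real.cos (i * x)) = fun i : ℕ => c i * Real.cos (i * x)
        - (∫ t in (-Real.pi)..Real.pi, Real.cos (i * t) * J t) * c i * Real.cos (i * x) := by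
    funext i; ring
  rw [e2]
  exact this

lemma jk_int_cos (n : ℤ) : ∫ t in (-Real.pi)..Real.pi, Real.cos (n * t)
    = if n = 0 then 2 * Real.pi else 0 := by
  split_ifs with h
  · subst h; simp; ring
  · have hn : (n : ℝ) ≠ 0 := by exact_mod_cast h
    rw [intervalIntegral.integral_comp_mul_left (fun t => Real.cos t) hn, integral_cos]
    simp [Real.sin_int_mul_pi]

/-- Unnormalised Fejer-Korovkin kernel. -/
def jkK (m : ℕ) (a : ℕ → ℝ) (t : ℝ) : ℝ :=
  ∑ j ∈ Finset.range (m + 1), ∑ l ∈ Finset.range (m + 1),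
    a j * a l * Real.cos ((((j : ℤ) - (l : ℤ) : ℤ) : ℝ) * t)

lemma jkK_nonneg (m : ℕ) (a : ℕ → ℝ) (t : ℝ) : 0 ≤ jkK m a t := by
  have : jkK m a t = (∑ j ∈ Finset.range (m + 1), a j * Real.cos (j * t)) ^ 2
      + (∑ j ∈ Finset.range (m + 1), a j * Real.sin (j * t)) ^ 2 := by
    rw [sq, sq, Finset.sum_mul_sum, Finset.sum_mul_sum, ← Finset.sum_add_distrib]
    refine Finset.sum_congr rfl fun j _ => ?_
    rw [← Finset.sum_add_distrib]
    refine Finset.sum_congr rfl fun l _ => ?_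
    push_cast
    rw [sub_mul, Real.cos_sub]; ring
  rw [this]; positivity

lemma jkK_cont (m : ℕ) (a : ℕ → ℝ) : Continuous (jkK m a) := by
  unfold jkK; fun_prop

lemma jkK_even (m : ℕ) (a : ℕ → ℝ) (t : ℝ) : jkK m a (-t) = jkK m a t := by
  unfold jkK; simp only [mul_neg, Real.cos_neg]

lemma jkK_coeff (m : ℕ) (a : ℕ → ℝ) (i : ℕ) :
    ∫ t in (-Real.pi)..Real.pi, Real.cos (i * t) * jkK m a t =
    ∑ j ∈ Finset.range (m + 1), ∑ l ∈ Finset.range (m + 1),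
      a j * a l * (((if l = j + i then Real.pi else 0) + (if j = l + i then Real.pi else 0))) := by
  unfold jkK
  simp only [Finset.mul_sum]
  rw [intervalIntegral.integral_finsetSum
    (fun j _ => Continuous.intervalIntegrable (by fun_prop) _ _)]
  refine Finset.sum_congr rfl fun j _ => ?_
  rw [intervalIntegral.integral_finsetSum
    (fun j _ => Continuous.intervalIntegrable (by fun_prop) _ _)]
  refine Finset.sum_congr rfl fun l _ => ?_
  have : ∀ t : ℝ, Real.cos (i * t) * (a j * a l * Real.cos ((((j : ℤ) - (l : ℤ) : ℤ) : ℝ) * t))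
      = (a j * a l / 2) * (Real.cos (((j + i - l : ℤ) : ℝ) * t)
        + Real.cos (((l + i - j : ℤ) : ℝ) * t)) := by
    intro t
    have h1 : ((j + i - l : ℤ) : ℝ) * t = i * t + (((j : ℤ) - (l : ℤ) : ℤ) : ℝ) * t := by
      push_cast; ring
    have h2 : ((l + i - j : ℤ) : ℝ) * t = i * t - (((j : ℤ) - (l : ℤ) : ℤ) : ℝ) * t := by
      push_cast; ring
    rw [h1, h2, Real.cos_add, Real.cos_sub]; ring
  simp only [this]
  rw [intervalIntegral.integral_const_mul, intervalIntegral.integral_add, jk_int_cos, jk_int_cos]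
  · have e1 : ((j + i - l : ℤ) = 0) ↔ l = j + i := by omega
    have e2 : ((l + i - j : ℤ) = 0) ↔ j = l + i := by omega
    simp only [e1, e2]
    split_ifs <;> ring
  · exact Continuous.intervalIntegrable (by fun_prop) _ _
  · exact Continuous.intervalIntegrable (by fun_prop) _ _

lemma jk_kernel (m : ℕ) : ∃ J : ℝ → ℝ, Continuous J ∧ (∀ t, 0 ≤ J t) ∧
    (∀ t, J (-t) = J t) ∧ ∫ t in (-Real.pi)..Real.pi, J t = 1 ∧
    (∀ i : ℕ, 0 ≤ ∫ t in (-Real.pi)..Real.pi, Real.cos (i * t) * J t) ∧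
    (∀ i : ℕ, m < i → ∫ t in (-Real.pi)..Real.pi, Real.cos (i * t) * J t = 0) ∧
    ∫ t in (-Real.pi)..Real.pi, Real.cos t * J t = Real.cos (Real.pi / (m + 2)) := by
  have hpi := Real.pi_pos
  set θ : ℝ := Real.pi / (m + 2) with hθ
  have hm2 : (0 : ℝ) < m + 2 := by positivity
  have hθm : (m + 2) * θ = Real.pi := by rw [hθ]; field_simp
  have hθ0 : 0 < θ := by positivity
  set a : ℕ → ℝ := fun j => Real.sin ((j + 1) * θ) with ha
  have ha0 : ∀ j ∈ Finset.range (m + 1), 0 < a j := by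
    intro j hj
    have : (j : ℝ) ≤ m := by exact_mod_cast Nat.lt_succ_iff.1 (Finset.mem_range.1 hj)
    apply Real.sin_pos_of_pos_of_lt_pi
    · positivity
    · rw [← hθm]; exact mul_lt_mul_of_pos_right (by linarith) hθ0
  set A : ℝ := 2 * Real.pi * ∑ j ∈ Finset.range (m + 1), a j ^ 2 with hA
  have hA0 : 0 < A := by
    have : 0 < ∑ j ∈ Finset.range (m + 1), a j ^ 2 :=
      Finset.sum_pos (fun j hj => pow_pos (ha0 j hj) 2) ⟨0, by simp⟩
    positivity
  have hc := jkK_coeff m a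
  have hdiv : ∀ u : ℝ → ℝ, ∫ t in (-Real.pi)..Real.pi, u t * (jkK m a t / A)
      = (∫ t in (-Real.pi)..Real.pi, u t * jkK m a t) / A := by
    intro u
    simp only [← mul_div_assoc]
    exact intervalIntegral.integral_div _ _
  refine ⟨fun t => jkK m a t / A, (jkK_cont m a).div_const _,
    fun t => div_nonneg (jkK_nonneg m a t) hA0.le, fun t => by simp only [jkK_even], ?_, ?_, ?_, ?_⟩
  · have h := hdiv (fun _ => 1)
    have h0 := hc 0
    simp only [one_mul, Nat.cast_zero, zero_mul, Real.cos_zero] at h h0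
    rw [h, h0, div_eq_one_iff_eq hA0.ne', hA, Finset.mul_sum]
    refine Finset.sum_congr rfl fun j hj => ?_
    rw [Finset.sum_eq_single_of_mem j hj]
    · simp; ring
    · intro l _ hl
      simp [hl, hl.symm]
  · intro i
    rw [hdiv, hc]
    refine div_nonneg (Finset.sum_nonneg fun j hj => Finset.sum_nonneg fun l hl => ?_) hA0.le
    have := ha0 j hj
    have := ha0 l hl
    refine mul_nonneg (by positivity) (add_nonneg ?_ ?_) <;> split_ifs <;> linarith
  · intro i hi
    rw [hdiv, hc]
    rw [Finset.sum_eq_zero, zero_div]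
    intro j hj
    refine Finset.sum_eq_zero fun l hl => ?_
    rw [Finset.mem_range] at hj hl
    rw [if_neg (by omega), if_neg (by omega)]; simp
  · have h1 := hc 1
    simp only [Nat.cast_one, one_mul] at h1
    rw [hdiv, h1, div_eq_iff hA0.ne', hA, Finset.mul_sum, Finset.mul_sum]
    refine Finset.sum_congr rfl fun j hj => ?_
    have hj' := Finset.mem_range.1 hj
    simp only [mul_add, Finset.sum_add_distrib]
    have s1 : ∑ l ∈ Finset.range (m + 1), a j * a l * (if l = j + 1 then Real.pi else 0)
        = a j * Real.sin ((j + 2) * θ) * Real.pi := by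
      simp only [mul_ite, mul_zero, Finset.sum_ite_eq', Finset.mem_range]
      split_ifs with h
      · simp only [ha]; push_cast; ring_nf
      · have : j = m := by omega
        rw [this, hθm]; simp
    have s2 : ∑ l ∈ Finset.range (m + 1), a j * a l * (if j = l + 1 then Real.pi else 0)
        = a j * Real.sin (j * θ) * Real.pi := by
      cases j with
      | zero => simp
      | succ p =>
        have : ∀ l, (p + 1 = l + 1) ↔ (l = p) := by intro l; omega
        simp only [this, mul_ite, mul_zero, Finset.sum_ite_eq', Finset.mem_range]
        rw [if_pos (by omega)]
        simp only [ha]; push_cast; ring_nf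
    rw [s1, s2]
    have t1 : ((j : ℝ) + 2) * θ = (j + 1) * θ + θ := by ring
    have t2 : (j : ℝ) * θ = (j + 1) * θ - θ := by ring
    rw [t1, t2, Real.sin_add, Real.sin_sub]
    simp only [ha]; ring

lemma jk_moment (m : ℕ) (hm : 1 ≤ m) {J : ℝ → ℝ} (hJ : Continuous J) (hJ0 : ∀ t, 0 ≤ J t)
    (hJ1 : ∫ t in (-Real.pi)..Real.pi, J t = 1)
    (hJc : ∫ t in (-Real.pi)..Real.pi, Real.cos t * J t = Real.cos (Real.pi / (m + 2))) :
    ∫ t in (-Real.pi)..Real.pi, |t| * J t ≤ (Real.pi ^ 4 / 8 + 1 / 2) / m := by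
  have hpi := Real.pi_pos
  have hm0 : (0 : ℝ) < m := by exact_mod_cast hm
  have hcos : 1 - Real.cos (Real.pi / (m + 2)) ≤ Real.pi ^ 2 / (2 * m ^ 2) := by
    have h1 := Real.one_sub_sq_div_two_le_cos (x := Real.pi / (m + 2))
    have h2 : Real.pi / (m + 2) ≤ Real.pi / m := by gcongr; linarith
    have h3 : (Real.pi / (m + 2)) ^ 2 ≤ (Real.pi / m) ^ 2 := by gcongr
    have h4 : Real.pi ^ 2 / (2 * m ^ 2) = (Real.pi / m) ^ 2 / 2 := by field_simp
    rw [h4]; linarith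
  calc ∫ t in (-Real.pi)..Real.pi, |t| * J t
      ≤ ∫ t in (-Real.pi)..Real.pi, ((m * Real.pi ^ 2 / 4 + 1 / (2 * m)) * J t
          - (m * Real.pi ^ 2 / 4) * (Real.cos t * J t)) := by
        apply intervalIntegral.integral_mono_on (by linarith)
        · exact Continuous.intervalIntegrable (by fun_prop) _ _
        · exact Continuous.intervalIntegrable (by fun_prop) _ _
        · intro t ht
          have hq := Real.cos_le_one_sub_mul_cos_sq (abs_le.2 ht)
          have e : (m * Real.pi ^ 2 / 4 + 1 / (2 * m)) * J t
            - (m * Real.pi ^ 2 / 4) * (Real.cos t * J t)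
            = (m * Real.pi ^ 2 / 4 * (1 - Real.cos t) + 1 / (2 * m)) * J t := by ring
          rw [e]
          refine mul_le_mul_of_nonneg_right ?_ (hJ0 t)
          have h1 : t ^ 2 ≤ Real.pi ^ 2 / 2 * (1 - Real.cos t) := by
            have : Real.pi ^ 2 / 2 * (2 / Real.pi ^ 2 * t ^ 2) = t ^ 2 := by field_simp
            rw [← this]
            refine mul_le_mul_of_nonneg_left ?_ (by positivity)
            linarith
          have h2 : |t| ≤ m / 2 * t ^ 2 + 1 / (2 * m) := by
            have : m / 2 * t ^ 2 + 1 / (2 * m) - |t| = (m * |t| - 1) ^ 2 / (2 * m) := by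
              rw [← sq_abs t]; field_simp; ring
            have h : 0 ≤ (m * |t| - 1) ^ 2 / (2 * m) := by positivity
            linarith
          have h3 := mul_le_mul_of_nonneg_left h1 (by positivity : 0 ≤ (m : ℝ) / 2)
          linarith
    _ = m * Real.pi ^ 2 / 4 * (1 - Real.cos (Real.pi / (m + 2))) + 1 / (2 * m) := by
        rw [intervalIntegral.integral_sub, intervalIntegral.integral_const_mul,
          intervalIntegral.integral_const_mul, hJ1, hJc]
        · ring
        · exact Continuous.intervalIntegrable (by fun_prop) _ _
        · exact Continuous.intervalIntegrable (by fun_prop) _ _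
    _ ≤ m * Real.pi ^ 2 / 4 * (Real.pi ^ 2 / (2 * m ^ 2)) + 1 / (2 * m) := by gcongr
    _ = (Real.pi ^ 4 / 8 + 1 / 2) / m := by field_simp; ring

/-- one-dimensional Jackson theorem for even `2π`-periodic `C^k`
functions with `‖g^{(k)}‖_∞ ≤ 1`: there is a degree-`m` cosine polynomial which is
`C₁^k/m^k`-close in sup norm and has coefficients dominated by those of `g`. -/
theorem jackson_one_dimensional_smooth :
    ∃ C₁ : ℝ, 0 < C₁ ∧
      ∀ m k : ℕ, 1 ≤ k → k ≤ m →
        ∀ g : ℝ → ℝ, (∀ x, g (-x) = g x) → Function.Periodic g (2 * Real.pi) →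
          ContDiff ℝ k g → (∀ x, |iteratedDeriv k g x| ≤ 1) →
          ∀ c : ℕ → ℝ, (∀ x, HasSum (fun i : ℕ => c i * Real.cos (i * x)) (g x)) →
            ∃ ct : ℕ → ℝ,
              (∀ x, |g x - ∑ i ∈ Finset.range (m + 1), ct i * Real.cos (i * x)| ≤
                C₁ ^ k / m ^ k) ∧
              ∀ i ≤ m, |ct i| ≤ |c i| := by
  refine ⟨Real.pi ^ 4 / 8 + 1 / 2, by positivity, ?_⟩
  intro m k hk hkm g _ _ hg hgk c hc
  obtain ⟨J, hJ, hJ0, hJe, hJ1, hl0, hlm, hJc⟩ := jk_kernel m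
  have hpi := Real.pi_pos
  have hδ := jk_moment m (hk.trans hkm) hJ hJ0 hJ1 hJc
  set L : ℕ → ℝ := fun i => ∫ t in (-Real.pi)..Real.pi, Real.cos (i * t) * J t with hL
  have hL1 : ∀ i, L i ≤ 1 := by
    intro i
    rw [← hJ1]
    apply intervalIntegral.integral_mono_on (by linarith)
    · exact Continuous.intervalIntegrable (by fun_prop) _ _
    · exact Continuous.intervalIntegrable (by fun_prop) _ _
    · intro t _
      exact mul_le_of_le_one_left (hJ0 t) (Real.cos_le_one _)
  have hcs : Summable fun i => |c i| := by
    have := (hc 0).summable.abs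
    simpa using this
  have hq0 : ∀ i n, 0 ≤ (1 - L i) ^ n := fun i n => pow_nonneg (by linarith [hL1 i]) n
  have hq1 : ∀ i n, (1 - L i) ^ n ≤ 1 := fun i n =>
    pow_le_one₀ (by linarith [hL1 i]) (by linarith [hl0 i])
  have hit : ∀ n : ℕ, ∀ x, HasSum (fun i : ℕ => ((1 - L i) ^ n * c i) * Real.cos (i * x))
      ((jkS J)^[n] g x) := by
    intro n
    induction n with
    | zero => intro x; simpa using hc x
    | succ n ih =>
      intro x
      rw [Function.iterate_succ_apply']
      have hs : Summable fun i => |(1 - L i) ^ n * c i| := by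
        refine Summable.of_nonneg_of_le (fun _ => abs_nonneg _) (fun i => ?_) hcs
        rw [abs_mul, abs_of_nonneg (hq0 i n)]
        exact mul_le_of_le_one_left (abs_nonneg _) (hq1 i n)
      have := jkS_hasSum hJ hJe hs ih x
      convert this using 2
      rw [pow_succ']; ring
  refine ⟨fun i => (1 - (1 - L i) ^ k) * c i, ?_, ?_⟩
  · intro x
    have h1 := (hc x).sub (hit k x)
    have h2 : HasSum (fun i : ℕ => c i * Real.cos (i * x)
        - ((1 - L i) ^ k * c i) * Real.cos (i * x))
        (∑ i ∈ Finset.range (m + 1), (c i * Real.cos (i * x)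
        - ((1 - L i) ^ k * c i) * Real.cos (i * x))) := by
      apply hasSum_sum_of_ne_finset_zero
      intro i hi
      have hi' : m < i := by simpa using hi
      have : L i = 0 := hlm i hi'
      rw [this]; simp
    have h3 := h1.unique h2
    have h4 : ∑ i ∈ Finset.range (m + 1), (1 - (1 - L i) ^ k) * c i * Real.cos (i * x)
        = g x - (jkS J)^[k] g x := by
      rw [h3]
      refine Finset.sum_congr rfl fun i _ => ?_
      ring
    rw [h4, sub_sub_cancel, ← div_pow]
    have := jkS_bound hJ hJ0 hJ1 hδ k 1 g hg hgk x
    rwa [one_mul] at this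
  · intro i _
    rw [abs_mul, abs_of_nonneg (by linarith [hq1 i k])]
    exact mul_le_of_le_one_left (abs_nonneg _) (by linarith [hq0 i k])

end
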